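/- arXiv:2601.15996 — 7 statements merged into one kernel-verified Lean document; each statement's English description precedes it below -/
import Mathlib

section
/- Let T : C → C be ρ-Lipschitz (ρ > 0) on a nonempty convex subset C of a real normed space, let (x^n) be Halpern iterates for a sequence (β_n) in [0,1], and suppose κ > 0 satisfies ‖T x^m − T x^n‖ ≤ κ for all m, n ∈ ℕ ∪ {−1}, with the convention T x^{−1} := x⁰. Then, with d_n, c_n, R_n the recursive bounds defined from ρ and (β_n), one has ‖x^n − x^{n−1}‖ ≤ κ d_n and ‖x^n − T x^n‖ ≤ κ R_n for all n ≥ 1. -/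
/-- The recursive bound `c_n`: `c₀ = 0` and
`c_{n} = min{1, ρ d_n}` with `d_n = |β_{n-1} - β_n| + min{β_{n-1}, β_n} c_{n-1}`. -/
noncomputable def cSeq (ρ : ℝ) (β : ℕ → ℝ) : ℕ → ℝ
  | 0 => 0
  | n + 1 => min 1 (ρ * (|β n - β (n + 1)| + min (β n) (β (n + 1)) * cSeq ρ β n))

/-- The recursive bound `d_n`: `d₀ = 0`,
`d_n = |β_{n-1} - β_n| + min{β_{n-1}, β_n} c_{n-1}` for `n ≥ 1`. -/
noncomputable def dSeq (ρ : ℝ) (β : ℕ → ℝ) : ℕ → ℝ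
  | 0 => 0
  | n + 1 => |β n - β (n + 1)| + min (β n) (β (n + 1)) * cSeq ρ β n

/-- The recursive bound `R_n = 1 - β_n (1 - c_n)` (with `β 0 = 0` this gives `R₀ = 1`). -/
noncomputable def Rseq (ρ : ℝ) (β : ℕ → ℝ) (n : ℕ) : ℝ :=
  1 - β n * (1 - cSeq ρ β n)

/-- `T x^{n-1}` for `n ∈ ℕ ∪ {-1}` encoded with a shift: index `0` stands for `T x^{-1} := x⁰`
and index `n+1` stands for `T x^n`. -/
def TmSeq {E : Type*} (T : E → E) (x : ℕ → E) : ℕ → E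
  | 0 => x 0
  | n + 1 => T (x n)

/-- The distance of two points on segments issuing from `a` is bounded with the distance of the far
endpoints is weighted by the smaller of the two parameters. -/
lemma norm_segment_sub_segment_le {E : Type*} [NormedAddCommGroup E] [NormedSpace ℝ E]
    (a u v : E) {s t κ : ℝ} (hs : 0 ≤ s) (ht : 0 ≤ t) (hu : ‖u - a‖ ≤ κ) (hv : ‖v - a‖ ≤ κ) :
    ‖((1 - t) • a + t • v) - ((1 - s) • a + s • u)‖ ≤ κ * |s - t| + min s t * ‖v - u‖ := by
  rcases le_total s t with h | h
  · have e : ((1 - t) • a + t • v) - ((1 - s) • a + s • u)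
        = (t - s) • (v - a) + s • (v - u) := by module
    rw [e, min_eq_left h, abs_sub_comm, mul_comm κ]
    refine (norm_add_le _ _).trans ?_
    rw [norm_smul, norm_smul, Real.norm_eq_abs, Real.norm_of_nonneg hs]
    gcongr
  · have e : ((1 - t) • a + t • v) - ((1 - s) • a + s • u)
        = (t - s) • (u - a) + t • (v - u) := by module
    rw [e, min_eq_right h, abs_sub_comm, mul_comm κ]
    refine (norm_add_le _ _).trans ?_
    rw [norm_smul, norm_smul, Real.norm_eq_abs, Real.norm_of_nonneg ht]
    gcongr

/-- For a `ρ`-Lipschitz self-map of a nonempty convex set, Halpern iterates with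
`β_n ∈ [0,1]` (with `β₀ = 0`), and `κ > 0` with `‖T x^m - T x^n‖ ≤ κ` for all
`m, n ∈ ℕ ∪ {-1}` (where `T x^{-1} := x⁰`), one has `‖x^n - x^{n-1}‖ ≤ κ d_n` and
`‖x^n - T x^n‖ ≤ κ R_n` for all `n ≥ 1`. -/
theorem halpern_recursive_bounds
    {E : Type*} [NormedAddCommGroup E] [NormedSpace ℝ E]
    {C : Set E} (hCne : C.Nonempty) (hCconv : Convex ℝ C)
    {ρ : ℝ} (hρ0 : 0 < ρ)
    {T : E → E} (hTmaps : Set.MapsTo T C C)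
    (hTlip : ∀ x ∈ C, ∀ y ∈ C, ‖T x - T y‖ ≤ ρ * ‖x - y‖)
    (β : ℕ → ℝ) (hβ0 : β 0 = 0) (hβ : ∀ n : ℕ, β n ∈ Set.Icc (0 : ℝ) 1)
    (x : ℕ → E) (hx0 : x 0 ∈ C)
    (hx : ∀ n : ℕ, x (n + 1) = (1 - β (n + 1)) • x 0 + β (n + 1) • T (x n))
    (κ : ℝ) (hκpos : 0 < κ)
    (hκ : ∀ m n : ℕ, ‖TmSeq T x m - TmSeq T x n‖ ≤ κ) :
    ∀ n : ℕ, 1 ≤ n →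
      ‖x n - x (n - 1)‖ ≤ κ * dSeq ρ β n ∧ ‖x n - T (x n)‖ ≤ κ * Rseq ρ β n := by
  have hseg : ∀ n, x n = (1 - β n) • x 0 + β n • TmSeq T x n := by
    rintro (_ | n)
    · simp [hβ0]
    · exact hx n
  have hxC : ∀ n, x n ∈ C := by
    intro n
    induction n with
    | zero => exact hx0
    | succ n ih =>
      rw [hx n]
      exact hCconv hx0 (hTmaps ih) (sub_nonneg.2 (hβ _).2) (hβ _).1 (by ring)
  have hstep : ∀ n, β n * ‖TmSeq T x (n + 1) - TmSeq T x n‖ ≤ β n * (κ * cSeq ρ β n) →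
      ‖x (n + 1) - x n‖ ≤ κ * dSeq ρ β (n + 1) := by
    intro n hn
    have hmin : min (β n) (β (n + 1)) * ‖TmSeq T x (n + 1) - TmSeq T x n‖
        ≤ min (β n) (β (n + 1)) * (κ * cSeq ρ β n) := by
      rcases (hβ n).1.eq_or_lt with h | h
      · simp [← h, (hβ (n + 1)).1]
      · exact mul_le_mul_of_nonneg_left (le_of_mul_le_mul_left hn h)
          (le_min (hβ n).1 (hβ (n + 1)).1)
    have h := norm_segment_sub_segment_le (x 0) (TmSeq T x n) (TmSeq T x (n + 1))
      (hβ n).1 (hβ (n + 1)).1 (hκ n 0) (hκ (n + 1) 0)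
    rw [← hseg n, ← hseg (n + 1)] at h
    simp only [dSeq]
    linarith
  have himage : ∀ n, β n * ‖TmSeq T x (n + 1) - TmSeq T x n‖ ≤ β n * (κ * cSeq ρ β n) := by
    intro n
    induction n with
    | zero => simp [hβ0]
    | succ n ih =>
      refine mul_le_mul_of_nonneg_left ?_ (hβ (n + 1)).1
      change _ ≤ κ * min 1 (ρ * dSeq ρ β (n + 1))
      rw [mul_min_of_nonneg _ _ hκpos.le, mul_one]
      refine le_min (hκ _ _) ((hTlip _ (hxC (n + 1)) _ (hxC n)).trans ?_)
      rw [mul_left_comm]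
      exact mul_le_mul_of_nonneg_left (hstep n ih) hρ0.le
  rintro (_ | n) hn
  · omega
  refine ⟨hstep n (himage n), ?_⟩
  have e : x (n + 1) - T (x (n + 1)) = (1 - β (n + 1)) • (TmSeq T x 0 - TmSeq T x (n + 2))
      + β (n + 1) • (TmSeq T x (n + 1) - TmSeq T x (n + 2)) := by
    change x (n + 1) - TmSeq T x (n + 2) = (1 - β (n + 1)) • (x 0 - TmSeq T x (n + 2)) + _
    nth_rewrite 1 [hseg (n + 1)]
    module
  have h1 : 0 ≤ 1 - β (n + 1) := sub_nonneg.2 (hβ _).2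
  have h2 := mul_le_mul_of_nonneg_left (hκ 0 (n + 2)) h1
  have h3 := himage (n + 1)
  rw [norm_sub_rev] at h3
  rw [e]
  refine (norm_add_le _ _).trans ?_
  rw [norm_smul, norm_smul, Real.norm_of_nonneg h1, Real.norm_of_nonneg (hβ _).1, Rseq]
  linarith
end

section
/- For every ρ > 0, κ > 0, and every sequence (β_n)_{n≥1} ⊆ [0,1], there exist a real normed space (X,‖·‖), a ρ-Lipschitz map T : X → X, and a point x⁰ ∈ X such that the Halpern iterates x^n = (1−β_n)x⁰ + β_n T x^{n−1} satisfy ‖T x^m − T x^n‖ ≤ κ for all m, n ∈ ℕ ∪ {−1} (with T x^{−1} := x⁰), and moreover ‖x^n − x^{n−1}‖ = κ d_n and ‖x^n − T x^n‖ = κ R_n for all n ≥ 1, where d_n and R_n are the recursive bounds defined from ρ and (β_n). -/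
open scoped ENNReal lp

/-- The distance prescribed between `T x^{m-1}` and `T x^{n-1}` (with `T x^{-1} := x⁰`):
the largest one compatible with `T` being `ρ`-Lipschitz and with the diameter bound `1`. -/
noncomputable def halpernDist (ρ : ℝ) (β : ℕ → ℝ) : ℕ → ℕ → ℝ
  | 0, 0 => 0
  | 0, _ + 1 => 1
  | _ + 1, 0 => 1
  | m + 1, n + 1 => min 1 (ρ * (|β m - β n| + min (β m) (β n) * halpernDist ρ β m n))

section halpernDist

variable {ρ : ℝ} {β : ℕ → ℝ}

lemma halpernDist_self (m : ℕ) : halpernDist ρ β m m = 0 := by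
  induction m with
  | zero => simp [halpernDist]
  | succ m ih => simp [halpernDist, ih]

lemma halpernDist_comm (m n : ℕ) : halpernDist ρ β m n = halpernDist ρ β n m := by
  induction m generalizing n with
  | zero => cases n <;> simp [halpernDist]
  | succ m ih =>
    cases n with
    | zero => simp [halpernDist]
    | succ n => simp only [halpernDist, ih n, abs_sub_comm (β m), min_comm (β m)]

lemma halpernDist_le_one (m n : ℕ) : halpernDist ρ β m n ≤ 1 := by
  cases m <;> cases n <;> simp [halpernDist]

lemma halpernDist_nonneg (hρ : 0 ≤ ρ) (hβ : ∀ n, β n ∈ Set.Icc (0 : ℝ) 1) (m n : ℕ) :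
    0 ≤ halpernDist ρ β m n := by
  induction m generalizing n with
  | zero => cases n <;> simp [halpernDist]
  | succ m ih =>
    cases n with
    | zero => simp [halpernDist]
    | succ n =>
      have h := ih n
      have h₁ := le_min (hβ m).1 (hβ n).1
      simp only [halpernDist]
      positivity

/-- Triangle inequality for the cost of transporting mass `a` at a point to mass `c` at another
one, the remaining mass of each being placed at a common base point at distance `1`. -/
lemma abs_sub_add_min_mul_triangle {a b c u v w : ℝ} (ha : 0 ≤ a) (hb : 0 ≤ b) (hc : 0 ≤ c)
    (hu : 0 ≤ u) (hv : 0 ≤ v) (hw : w ≤ 1) (h : w ≤ u + v) :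
    |a - c| + min a c * w ≤ (|a - b| + min a b * u) + (|b - c| + min b c * v) := by
  wlog hac : a ≤ c generalizing a c u v
  · have := this hc ha hv hu (by linarith) (le_of_not_ge hac)
    rw [abs_sub_comm a c, min_comm a c, abs_sub_comm a b, min_comm a b, abs_sub_comm b c,
      min_comm b c]
    linarith
  rw [min_eq_left hac, abs_of_nonpos (sub_nonpos.2 hac)]
  rcases le_total a b with hab | hab
  · have h₁ : a * v ≤ min b c * v := mul_le_mul_of_nonneg_right (le_min hab hac) hv
    have h₂ : a * w ≤ a * (u + v) := mul_le_mul_of_nonneg_left h ha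
    have h₄ : c - a ≤ |a - b| + |b - c| := by
      linarith [neg_le_abs (a - b), neg_le_abs (b - c)]
    rw [min_eq_left hab]
    linarith
  · rw [min_eq_right hab, min_eq_left (hab.trans hac), abs_of_nonneg (sub_nonneg.2 hab),
      abs_of_nonpos (sub_nonpos.2 (hab.trans hac))]
    have h₁ : (a - b) * w ≤ (a - b) * 1 := mul_le_mul_of_nonneg_left hw (sub_nonneg.2 hab)
    have h₂ : b * w ≤ b * (u + v) := mul_le_mul_of_nonneg_left h hb
    linarith

lemma halpernDist_triangle (hρ : 0 ≤ ρ) (hβ : ∀ n, β n ∈ Set.Icc (0 : ℝ) 1) (m k n : ℕ) :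
    halpernDist ρ β m n ≤ halpernDist ρ β m k + halpernDist ρ β k n := by
  induction m generalizing k n with
  | zero =>
    cases k with
    | zero => simp [halpernDist]
    | succ k =>
      have h := halpernDist_nonneg hρ hβ (k + 1) n
      have h₁ := halpernDist_le_one (ρ := ρ) (β := β) 0 n
      simp only [halpernDist] at *
      linarith
  | succ m ih =>
    have h₁ := halpernDist_le_one (ρ := ρ) (β := β) (m + 1) n
    cases k with
    | zero =>
      have h := halpernDist_nonneg hρ hβ 0 n
      simp only [halpernDist] at *
      linarith
    | succ k =>
      cases n with
      | zero =>
        have h := halpernDist_nonneg hρ hβ (m + 1) (k + 1)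
        simp only [halpernDist] at *
        linarith
      | succ n =>
        have hmk := halpernDist_nonneg hρ hβ (m + 1) (k + 1)
        have hkn := halpernDist_nonneg hρ hβ (k + 1) (n + 1)
        have h := mul_le_mul_of_nonneg_left (abs_sub_add_min_mul_triangle (hβ m).1 (hβ k).1
          (hβ n).1 (halpernDist_nonneg hρ hβ m k) (halpernDist_nonneg hρ hβ k n)
          (halpernDist_le_one m n) (ih k n)) hρ
        have h₂ : halpernDist ρ β (m + 1) (n + 1) ≤ _ := min_le_right _ _
        rw [mul_add] at h
        simp only [halpernDist] at *
        rcases min_choice 1 (ρ * (|β m - β k| + min (β m) (β k) * halpernDist ρ β m k)) with e | e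
        · linarith
        rcases min_choice 1 (ρ * (|β k - β n| + min (β k) (β n) * halpernDist ρ β k n)) with e' | e'
        · linarith
        · linarith

lemma abs_halpernDist_sub_le (hρ : 0 ≤ ρ) (hβ : ∀ n, β n ∈ Set.Icc (0 : ℝ) 1) (m n k : ℕ) :
    |halpernDist ρ β m k - halpernDist ρ β n k| ≤ halpernDist ρ β m n := by
  have h₁ := halpernDist_triangle hρ hβ m n k
  have h₂ := halpernDist_triangle hρ hβ n m k
  rw [halpernDist_comm n m] at h₂
  rw [abs_le]
  constructor <;> linarith

lemma halpernDist_zero_left {n : ℕ} (hn : n ≠ 0) : halpernDist ρ β 0 n = 1 := by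
  cases n with
  | zero => contradiction
  | succ n => rfl

lemma halpernDist_succ_self (hβ0 : β 0 = 0) (hβ : ∀ n, β n ∈ Set.Icc (0 : ℝ) 1) {n : ℕ}
    (hn : 1 ≤ n) : halpernDist ρ β n (n + 1) = cSeq ρ β n := by
  induction n, hn using Nat.le_induction with
  | base => simp [halpernDist, cSeq, hβ0, (hβ 1).1]
  | succ n _ ih =>
    rw [halpernDist, ih, cSeq]

/-- The scaled Kuratowski embedding of `ℕ` with the distance `halpernDist`. -/
noncomputable def halpernEmb (κ ρ : ℝ) (β : ℕ → ℝ) (hρ : 0 ≤ ρ)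
    (hβ : ∀ n, β n ∈ Set.Icc (0 : ℝ) 1) (n : ℕ) : ℓ^∞(ℕ, ℝ) :=
  κ • ⟨fun k => halpernDist ρ β n k, memℓp_infty ⟨1, by
    rintro _ ⟨k, rfl⟩
    exact (Real.norm_of_nonneg (halpernDist_nonneg hρ hβ n k)).trans_le (halpernDist_le_one n k)⟩⟩

variable {κ : ℝ} (hρ : 0 ≤ ρ) (hβ : ∀ n, β n ∈ Set.Icc (0 : ℝ) 1)

lemma halpernEmb_apply (n k : ℕ) :
    halpernEmb κ ρ β hρ hβ n k = κ * halpernDist ρ β n k := rfl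

/-- Norm of a combination `s (y_i - y_k) + t (y_j - y_k)` with nonnegative coefficients: it is
attained at the coordinate `k`. -/
lemma norm_halpernEmb_comb (hκ : 0 ≤ κ) {s t : ℝ} (hs : 0 ≤ s) (ht : 0 ≤ t) (i j k : ℕ) :
    ‖s • (halpernEmb κ ρ β hρ hβ i - halpernEmb κ ρ β hρ hβ k) +
      t • (halpernEmb κ ρ β hρ hβ j - halpernEmb κ ρ β hρ hβ k)‖ =
    κ * (s * halpernDist ρ β i k + t * halpernDist ρ β j k) := by
  have hik := halpernDist_nonneg hρ hβ i k
  have hjk := halpernDist_nonneg hρ hβ j k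
  have hcoord (l : ℕ) : (s • (halpernEmb κ ρ β hρ hβ i - halpernEmb κ ρ β hρ hβ k) +
      t • (halpernEmb κ ρ β hρ hβ j - halpernEmb κ ρ β hρ hβ k)) l =
      κ * (s * (halpernDist ρ β i l - halpernDist ρ β k l) +
        t * (halpernDist ρ β j l - halpernDist ρ β k l)) := by
    change s * (halpernEmb κ ρ β hρ hβ i l - halpernEmb κ ρ β hρ hβ k l) +
      t * (halpernEmb κ ρ β hρ hβ j l - halpernEmb κ ρ β hρ hβ k l) = _
    simp only [halpernEmb_apply]
    ring
  apply le_antisymm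
  · refine lp.norm_le_of_forall_le (by positivity) fun l => ?_
    rw [hcoord, norm_mul, Real.norm_of_nonneg hκ]
    gcongr
    refine (norm_add_le _ _).trans ?_
    rw [norm_mul, norm_mul, Real.norm_of_nonneg hs, Real.norm_of_nonneg ht]
    gcongr
    · exact abs_halpernDist_sub_le hρ hβ i k l
    · exact abs_halpernDist_sub_le hρ hβ j k l
  · refine le_trans ?_ (lp.norm_apply_le_norm ENNReal.top_ne_zero _ k)
    rw [hcoord, halpernDist_self, sub_zero, sub_zero]
    exact le_abs_self _

lemma norm_halpernEmb_sub (hκ : 0 ≤ κ) (m n : ℕ) :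
    ‖halpernEmb κ ρ β hρ hβ m - halpernEmb κ ρ β hρ hβ n‖ = κ * halpernDist ρ β m n := by
  simpa using norm_halpernEmb_comb hρ hβ hκ zero_le_one le_rfl m m n

/-- The iterate `(1 - β_n) x⁰ + β_n T x^{n-1}`, where `T x^{n-1}` is the `n`-th embedded point. -/
noncomputable def halpernIter (κ ρ : ℝ) (β : ℕ → ℝ) (hρ : 0 ≤ ρ)
    (hβ : ∀ n, β n ∈ Set.Icc (0 : ℝ) 1) (n : ℕ) : ℓ^∞(ℕ, ℝ) :=
  (1 - β n) • halpernEmb κ ρ β hρ hβ 0 + β n • halpernEmb κ ρ β hρ hβ n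

lemma norm_halpernIter_sub (hβ0 : β 0 = 0) (hκ : 0 ≤ κ) (m n : ℕ) :
    ‖halpernIter κ ρ β hρ hβ m - halpernIter κ ρ β hρ hβ n‖ =
      κ * (|β m - β n| + min (β m) (β n) * halpernDist ρ β m n) := by
  wlog hmn : β m ≤ β n generalizing m n
  · rw [norm_sub_rev, this n m (le_of_not_ge hmn), abs_sub_comm, min_comm, halpernDist_comm]
  have key : halpernIter κ ρ β hρ hβ m - halpernIter κ ρ β hρ hβ n =
      (β n - β m) • (halpernEmb κ ρ β hρ hβ 0 - halpernEmb κ ρ β hρ hβ n) +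
      β m • (halpernEmb κ ρ β hρ hβ m - halpernEmb κ ρ β hρ hβ n) := by
    simp only [halpernIter]
    module
  rw [key, norm_halpernEmb_comb hρ hβ hκ (sub_nonneg.2 hmn) (hβ m).1, min_eq_left hmn,
    abs_of_nonpos (sub_nonpos.2 hmn), neg_sub]
  rcases eq_or_ne n 0 with rfl | hn
  · have : β m = 0 := le_antisymm (hβ0 ▸ hmn) (hβ m).1
    simp [this, hβ0]
  · rw [halpernDist_zero_left hn, mul_one]

lemma norm_halpernIter_sub_halpernEmb (hκ : 0 ≤ κ) (n : ℕ) :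
    ‖halpernIter κ ρ β hρ hβ n - halpernEmb κ ρ β hρ hβ (n + 1)‖ =
      κ * (1 - β n + β n * halpernDist ρ β n (n + 1)) := by
  have key : halpernIter κ ρ β hρ hβ n - halpernEmb κ ρ β hρ hβ (n + 1) =
      (1 - β n) • (halpernEmb κ ρ β hρ hβ 0 - halpernEmb κ ρ β hρ hβ (n + 1)) +
      β n • (halpernEmb κ ρ β hρ hβ n - halpernEmb κ ρ β hρ hβ (n + 1)) := by
    simp only [halpernIter]
    module
  rw [key, norm_halpernEmb_comb hρ hβ hκ (sub_nonneg.2 (hβ n).2) (hβ n).1,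
    halpernDist_zero_left n.succ_ne_zero, mul_one]

end halpernDist

/-- A relation `x n ↦ y n` into `ℓ^∞` which does not expand distances by more than `K` extends
to a `K`-Lipschitz map. -/
lemma exists_lipschitzWith_of_dist_le {α ι κ : Type*} [PseudoMetricSpace α] [Nonempty ι]
    {K : NNReal} (x : ι → α) (y : ι → ℓ^∞(κ, ℝ))
    (h : ∀ m n, dist (y m) (y n) ≤ K * dist (x m) (x n)) :
    ∃ T : α → ℓ^∞(κ, ℝ), LipschitzWith K T ∧ ∀ n, T (x n) = y n := by
  have hinv (n : ι) : x (Function.invFun x (x n)) = x n := Function.invFun_eq ⟨n, rfl⟩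
  have hlip : LipschitzOnWith K (y ∘ Function.invFun x) (Set.range x) := by
    refine LipschitzOnWith.of_dist_le_mul ?_
    rintro _ ⟨m, rfl⟩ _ ⟨n, rfl⟩
    simpa only [hinv, Function.comp_apply] using
      h (Function.invFun x (x m)) (Function.invFun x (x n))
  obtain ⟨T, hT, hTx⟩ := hlip.extend_lp_infty
  refine ⟨T, hT, fun n => ?_⟩
  rw [← hTx ⟨n, rfl⟩, ← dist_le_zero]
  simpa only [hinv, dist_self, mul_zero, Function.comp_apply] using
    h (Function.invFun x (x n)) n

/-- tightness: for every `ρ > 0`, `κ > 0` and `(β_n) ⊆ [0,1]` (with `β₀ = 0`)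
there are a real normed space, a `ρ`-Lipschitz map `T : X → X` and a point `x⁰` whose
Halpern iterates satisfy `‖T x^m - T x^n‖ ≤ κ` for all `m, n ∈ ℕ ∪ {-1}`, and attain
`‖x^n - x^{n-1}‖ = κ d_n` and `‖x^n - T x^n‖ = κ R_n` for all `n ≥ 1`. -/
theorem halpern_recursive_bounds_tight
    (ρ : ℝ) (hρ0 : 0 < ρ) (κ : ℝ) (hκpos : 0 < κ)
    (β : ℕ → ℝ) (hβ0 : β 0 = 0) (hβ : ∀ n : ℕ, β n ∈ Set.Icc (0 : ℝ) 1) :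
    ∃ (X : Type) (_ : NormedAddCommGroup X) (_ : NormedSpace ℝ X)
      (T : X → X) (x : ℕ → X),
      (∀ a b : X, ‖T a - T b‖ ≤ ρ * ‖a - b‖) ∧
      (∀ n : ℕ, x (n + 1) = (1 - β (n + 1)) • x 0 + β (n + 1) • T (x n)) ∧
      (∀ m n : ℕ, ‖TmSeq T x m - TmSeq T x n‖ ≤ κ) ∧
      (∀ n : ℕ, 1 ≤ n → ‖x n - x (n - 1)‖ = κ * dSeq ρ β n) ∧
      (∀ n : ℕ, 1 ≤ n → ‖x n - T (x n)‖ = κ * Rseq ρ β n) := by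
  have hρ := hρ0.le
  have hκ := hκpos.le
  set y := halpernEmb κ ρ β hρ hβ with hy
  set x := halpernIter κ ρ β hρ hβ with hx
  obtain ⟨T, hT, hTx⟩ := exists_lipschitzWith_of_dist_le (K := ⟨ρ, hρ⟩) x (fun n => y (n + 1))
    (fun m n => by
      rw [dist_eq_norm, dist_eq_norm, norm_halpernEmb_sub hρ hβ hκ,
        norm_halpernIter_sub hρ hβ hβ0 hκ, mul_left_comm]
      exact mul_le_mul_of_nonneg_left (min_le_right _ _) hκ)
  have hx0 : x 0 = y 0 := by simp [hx, hy, halpernIter, hβ0]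
  have hTm (n : ℕ) : TmSeq T x n = y n := by
    cases n with
    | zero => exact hx0
    | succ n => exact hTx n
  refine ⟨ℓ^∞(ℕ, ℝ), inferInstance, inferInstance, T, x, fun a b => ?_, fun n => ?_, fun m n => ?_,
    fun n hn => ?_, fun n hn => ?_⟩
  · rw [← dist_eq_norm, ← dist_eq_norm]
    exact hT.dist_le_mul a b
  · rw [hTx, hx0]
    rfl
  · rw [hTm, hTm, norm_halpernEmb_sub hρ hβ hκ]
    exact mul_le_of_le_one_right hκ (halpernDist_le_one m n)
  · obtain ⟨n, rfl⟩ := Nat.exists_eq_add_of_le' hn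
    rw [Nat.add_sub_cancel, norm_sub_rev, norm_halpernIter_sub hρ hβ hβ0 hκ, dSeq]
    rcases Nat.eq_zero_or_pos n with rfl | hn0
    · simp [hβ0, (hβ 1).1]
    · rw [halpernDist_succ_self hβ0 hβ hn0]
  · rw [hTx, norm_halpernIter_sub_halpernEmb hρ hβ hκ, halpernDist_succ_self hβ0 hβ hn, Rseq]
    ring
end

section
/- Fix ρ > 0 and n ≥ 1, and let R_n(β₁,…,β_n) denote the recursive bound as a function of (β₁,…,β_n) ∈ [0,1]^n. Then the minimum R*_n of R_n over [0,1]^n is attained at some point of the set S_n = {β ∈ [0,1]^n : β_n ≥ β_{n−1}} (where β₀ := 0 when n = 1); moreover R*_n < 1 and R*_n = min over β ∈ S_n of 1 − β_n + ρ β_n² + ρ β_n (R_{n−1}(β₁,…,β_{n−1}) − 1). -/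
theorem cSeq_le_one (ρ : ℝ) (β : ℕ → ℝ) (n : ℕ) : cSeq ρ β n ≤ 1 := by
  cases n with
  | zero => simp [cSeq]
  | succ n => exact min_le_left _ _

theorem cSeq_congr (ρ : ℝ) {β γ : ℕ → ℝ} {n : ℕ} (h : ∀ i ≤ n, β i = γ i) :
    cSeq ρ β n = cSeq ρ γ n := by
  induction n with
  | zero => rfl
  | succ n ih =>
    simp only [cSeq]
    rw [ih fun i hi => h i (by omega), h n (by omega), h (n + 1) le_rfl]

theorem cSeq_update_succ (ρ : ℝ) (β : ℕ → ℝ) (n : ℕ) (t : ℝ) :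
    cSeq ρ (Function.update β (n + 1) t) n = cSeq ρ β n :=
  cSeq_congr ρ fun i hi => Function.update_of_ne (by omega) _ _

theorem continuous_cSeq (ρ : ℝ) (n : ℕ) : Continuous fun β : ℕ → ℝ => cSeq ρ β n := by
  induction n with
  | zero => exact continuous_const
  | succ n ih =>
    simp only [cSeq]
    fun_prop

theorem continuous_Rseq (ρ : ℝ) (n : ℕ) : Continuous fun β : ℕ → ℝ => Rseq ρ β n := by
  have := continuous_cSeq ρ n
  unfold Rseq
  fun_prop

/-- The minimum of `R_n` over the cube is attained, by compactness. -/
theorem exists_Rseq_minimizer (ρ : ℝ) (n : ℕ) :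
    ∃ β : ℕ → ℝ, (β 0 = 0 ∧ ∀ i, β i ∈ Set.Icc (0 : ℝ) 1) ∧
      ∀ γ : ℕ → ℝ, γ 0 = 0 → (∀ i, γ i ∈ Set.Icc (0 : ℝ) 1) → Rseq ρ β n ≤ Rseq ρ γ n := by
  have hK : IsCompact ({β : ℕ → ℝ | β 0 = 0} ∩ Set.univ.pi fun _ => Set.Icc (0 : ℝ) 1) :=
    (isCompact_univ_pi fun _ => isCompact_Icc).inter_left
      (isClosed_eq (continuous_apply 0) continuous_const)
  obtain ⟨β, hβ, hmin⟩ := hK.exists_isMinOn ⟨0, rfl, fun _ _ => by simp⟩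
    (continuous_Rseq ρ n).continuousOn
  exact ⟨β, ⟨hβ.1, fun i => hβ.2 i trivial⟩,
    fun γ h0 hγ => hmin ⟨h0, fun i _ => hγ i⟩⟩

/-- Raising a decreasing last parameter to its predecessor does not increase `R_n`. -/
theorem Rseq_update_le {ρ : ℝ} (hρ : 0 ≤ ρ) {β : ℕ → ℝ} {n : ℕ} (h0 : 0 ≤ β (n + 1))
    (h : β (n + 1) ≤ β n) :
    Rseq ρ (Function.update β (n + 1) (β n)) (n + 1) ≤ Rseq ρ β (n + 1) := by
  have hc := cSeq_le_one ρ β n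
  have hle : cSeq ρ (Function.update β (n + 1) (β n)) (n + 1) ≤ cSeq ρ β (n + 1) := by
    have hn : Function.update β (n + 1) (β n) n = β n := Function.update_of_ne (by omega) _ _
    simp only [cSeq, cSeq_update_succ, hn, Function.update_self]
    rw [sub_self, abs_zero, min_self, min_eq_right h, abs_of_nonneg (sub_nonneg.2 h)]
    refine min_le_min_left _ (mul_le_mul_of_nonneg_left ?_ hρ)
    nlinarith [mul_nonneg (sub_nonneg.2 h) (sub_nonneg.2 hc)]
  have h1 := cSeq_le_one ρ β (n + 1)
  simp only [Rseq, Function.update_self]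
  nlinarith [mul_le_mul h (sub_le_sub_left hle 1) (by linarith) (h0.trans h)]

theorem exists_Rseq_lt_one {ρ : ℝ} (hρ : 0 < ρ) (n : ℕ) :
    ∃ β : ℕ → ℝ, β 0 = 0 ∧ (∀ i, β i ∈ Set.Icc (0 : ℝ) 1) ∧ Rseq ρ β (n + 1) < 1 := by
  obtain ⟨t, ht, h1, hρt⟩ : ∃ t : ℝ, 0 < t ∧ t ≤ 1 ∧ ρ * t < 1 :=
    ⟨1 / (1 + ρ), by positivity, by rw [div_le_one (by positivity)]; linarith, by
      rw [mul_one_div, div_lt_one (by positivity)]; linarith⟩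
  refine ⟨Function.update 0 (n + 1) t, by simp [Function.update], fun i => ?_, ?_⟩
  · by_cases hi : i = n + 1
    · subst hi
      simp [ht.le, h1]
    · simp [Function.update_of_ne hi]
  · have hc : cSeq ρ (Function.update 0 (n + 1) t) (n + 1) ≤ ρ * t := by
      simp [cSeq, abs_of_pos ht, min_eq_left ht.le]
    have := mul_pos ht (sub_pos.2 (hc.trans_lt hρt))
    simp only [Rseq, Function.update_self]
    linarith

/-- When the last parameter is nondecreasing, the quadratic expression in it is `R_n` without the
truncation of `c_n` at `1`. -/
theorem quadratic_eq_of_le (ρ : ℝ) {β : ℕ → ℝ} {n : ℕ} (h : β n ≤ β (n + 1)) :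
    1 - β (n + 1) + ρ * β (n + 1) ^ 2 + ρ * β (n + 1) * (Rseq ρ β n - 1) =
      1 - β (n + 1) *
        (1 - ρ * (|β n - β (n + 1)| + min (β n) (β (n + 1)) * cSeq ρ β n)) := by
  rw [Rseq, abs_of_nonpos (sub_nonpos.2 h), min_eq_left h]
  ring

theorem Rseq_le_quadratic (ρ : ℝ) {β : ℕ → ℝ} {n : ℕ} (h0 : 0 ≤ β (n + 1))
    (h : β n ≤ β (n + 1)) :
    Rseq ρ β (n + 1) ≤
      1 - β (n + 1) + ρ * β (n + 1) ^ 2 + ρ * β (n + 1) * (Rseq ρ β n - 1) := by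
  rw [quadratic_eq_of_le ρ h, Rseq, cSeq]
  gcongr
  exact min_le_right _ _

theorem Rseq_eq_quadratic (ρ : ℝ) {β : ℕ → ℝ} {n : ℕ} (h : β n ≤ β (n + 1))
    (hR : Rseq ρ β (n + 1) < 1) :
    Rseq ρ β (n + 1) =
      1 - β (n + 1) + ρ * β (n + 1) ^ 2 + ρ * β (n + 1) * (Rseq ρ β n - 1) := by
  rw [quadratic_eq_of_le ρ h]
  rw [Rseq, cSeq] at hR ⊢
  rcases min_choice 1 (ρ * (|β n - β (n + 1)| + min (β n) (β (n + 1)) * cSeq ρ β n)) with hm | hm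
  · rw [hm] at hR
    simp at hR
  · rw [hm]

theorem exists_Rseq_minimizer_le {ρ : ℝ} (hρ : 0 ≤ ρ) (n : ℕ) :
    ∃ β : ℕ → ℝ, (β 0 = 0 ∧ (∀ i, β i ∈ Set.Icc (0 : ℝ) 1) ∧ β n ≤ β (n + 1)) ∧
      ∀ γ : ℕ → ℝ, γ 0 = 0 → (∀ i, γ i ∈ Set.Icc (0 : ℝ) 1) →
        Rseq ρ β (n + 1) ≤ Rseq ρ γ (n + 1) := by
  obtain ⟨β, ⟨h0, hβ⟩, hmin⟩ := exists_Rseq_minimizer ρ (n + 1)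
  rcases le_total (β n) (β (n + 1)) with h | h
  · exact ⟨β, ⟨h0, hβ, h⟩, hmin⟩
  · refine ⟨Function.update β (n + 1) (β n), ⟨?_, fun i => ?_, ?_⟩, fun γ hγ0 hγ =>
      (Rseq_update_le hρ (hβ _).1 h).trans (hmin γ hγ0 hγ)⟩
    · rwa [Function.update_of_ne (by omega)]
    · by_cases hi : i = n + 1
      · subst hi
        simpa using hβ n
      · simpa [Function.update_of_ne hi] using hβ i
    · rw [Function.update_self, Function.update_of_ne (by omega)]

/-- for `ρ > 0` and `n ≥ 1`, the minimum `R*_n` of `R_n(β₁,…,β_n)` over `[0,1]^n`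
exists, it is attained at some point of `S_n = {β : β_n ≥ β_{n-1}}`, it satisfies `R*_n < 1`,
and it equals the minimum over `S_n` of `1 - β_n + ρ β_n² + ρ β_n (R_{n-1}(β₁,…,β_{n-1}) - 1)`. -/
theorem Rseq_min_on_Sn (ρ : ℝ) (hρ : 0 < ρ) (n : ℕ) (hn : 1 ≤ n) :
    ∃ R : ℝ,
      IsLeast {r : ℝ | ∃ β : ℕ → ℝ, β 0 = 0 ∧ (∀ i, β i ∈ Set.Icc (0 : ℝ) 1) ∧
        r = Rseq ρ β n} R ∧
      (∃ β : ℕ → ℝ, β 0 = 0 ∧ (∀ i, β i ∈ Set.Icc (0 : ℝ) 1) ∧ β (n - 1) ≤ β n ∧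
        Rseq ρ β n = R) ∧
      R < 1 ∧
      IsLeast {r : ℝ | ∃ β : ℕ → ℝ, β 0 = 0 ∧ (∀ i, β i ∈ Set.Icc (0 : ℝ) 1) ∧
        β (n - 1) ≤ β n ∧
        r = 1 - β n + ρ * (β n) ^ 2 + ρ * β n * (Rseq ρ β (n - 1) - 1)} R := by
  obtain ⟨m, rfl⟩ := Nat.exists_eq_add_of_le' hn
  simp only [Nat.add_sub_cancel]
  obtain ⟨β, ⟨h0, hβ, hle⟩, hmin⟩ := exists_Rseq_minimizer_le hρ.le m
  have hlt : Rseq ρ β (m + 1) < 1 := by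
    obtain ⟨γ, hγ0, hγ, hγR⟩ := exists_Rseq_lt_one hρ m
    exact (hmin γ hγ0 hγ).trans_lt hγR
  refine ⟨Rseq ρ β (m + 1), ⟨⟨β, h0, hβ, rfl⟩, ?_⟩, ⟨β, h0, hβ, hle, rfl⟩, hlt,
    ⟨β, h0, hβ, hle, Rseq_eq_quadratic ρ hle hlt⟩, ?_⟩
  · rintro _ ⟨γ, hγ0, hγ, rfl⟩
    exact hmin γ hγ0 hγ
  · rintro _ ⟨γ, hγ0, hγ, hγle, rfl⟩
    exact (hmin γ hγ0 hγ).trans (Rseq_le_quadratic ρ (hγ _).1 hγle)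
end

section
/- Fix ρ > 0 and let β*_n, R*_n be the minimax-optimal sequences (β*₀ = 0, R*₀ = 1, β*_n = B_ρ(R*_{n−1}), R*_n = V_ρ(R*_{n−1})). Let T : C → C be ρ-Lipschitz on a nonempty convex subset C of a real normed space, let (x^n) be the Halpern iterates x^n = (1−β*_n)x⁰ + β*_n T x^{n−1}, and suppose κ₀ satisfies ‖x⁰ − T x^n‖ ≤ κ₀ for all n ∈ ℕ. Then ‖x^n − T x^n‖ ≤ κ₀ R*_n for all n ∈ ℕ. Moreover this bound is tight: there exist a real normed space, a ρ-Lipschitz map T on it, and a corresponding Halpern sequence with these β*_n satisfying ‖x⁰ − T x^n‖ ≤ κ₀ for all n and ‖x^n − T x^n‖ = κ₀ R*_n for all n. -/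
/-- `V_ρ(r) = min_{β ∈ [0,1]} (1 - β + ρβ² + ρβ(r-1))`. -/
noncomputable def Vq (ρ r : ℝ) : ℝ :=
  sInf ((fun b : ℝ => 1 - b + ρ * b ^ 2 + ρ * b * (r - 1)) '' Set.Icc 0 1)

/-- `B_ρ(r) = min{1, (1/ρ + 1 - r)/2}`, the minimizer of the quadratic over `[0,1]`. -/
noncomputable def Bq (ρ r : ℝ) : ℝ := min 1 ((1 / ρ + 1 - r) / 2)

/-- The minimax-optimal bounds: `R*₀ = 1`, `R*_n = V_ρ(R*_{n-1})`. -/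
noncomputable def RStar (ρ : ℝ) : ℕ → ℝ
  | 0 => 1
  | n + 1 => Vq ρ (RStar ρ n)

/-- The minimax-optimal parameters: `β*₀ = 0`, `β*_n = B_ρ(R*_{n-1})`. -/
noncomputable def betaStar (ρ : ℝ) : ℕ → ℝ
  | 0 => 0
  | n + 1 => Bq ρ (RStar ρ n)

theorem isLeast_quadratic_Bq {ρ r : ℝ} (hρ : 0 < ρ) (hr : r ≤ 1) :
    IsLeast ((fun b : ℝ => 1 - b + ρ * b ^ 2 + ρ * b * (r - 1)) '' Set.Icc 0 1)
      (1 - Bq ρ r + ρ * Bq ρ r ^ 2 + ρ * Bq ρ r * (r - 1)) := by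
  have hinv : 0 < 1 / ρ := by positivity
  have hcancel : ρ * (1 / ρ) = 1 := by field_simp
  refine ⟨⟨Bq ρ r, ⟨le_min zero_le_one (by linarith), min_le_left _ _⟩, rfl⟩, ?_⟩
  rintro _ ⟨b, ⟨-, hb⟩, rfl⟩
  have key : 0 ≤ ρ * ((b - Bq ρ r) * (b + Bq ρ r - (1 / ρ + 1 - r))) := by
    refine mul_nonneg hρ.le ?_
    rcases le_total 1 ((1 / ρ + 1 - r) / 2) with h | h
    · rw [Bq, min_eq_left h]
      exact mul_nonneg_of_nonpos_of_nonpos (by linarith) (by linarith)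
    · rw [Bq, min_eq_right h]
      nlinarith [sq_nonneg (b - (1 / ρ + 1 - r) / 2)]
  have expand : ρ * ((b - Bq ρ r) * (b + Bq ρ r - (1 / ρ + 1 - r)))
      = ρ * (b ^ 2 - Bq ρ r ^ 2) - (ρ * (1 / ρ)) * (b - Bq ρ r)
        + ρ * (r - 1) * (b - Bq ρ r) := by ring
  rw [expand, hcancel] at key
  simp only
  linarith

theorem Vq_eq {ρ r : ℝ} (hρ : 0 < ρ) (hr : r ≤ 1) :
    Vq ρ r = 1 - Bq ρ r + ρ * Bq ρ r ^ 2 + ρ * Bq ρ r * (r - 1) :=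
  (isLeast_quadratic_Bq hρ hr).csInf_eq

theorem Vq_le {ρ r b : ℝ} (hρ : 0 < ρ) (hr : r ≤ 1) (hb : b ∈ Set.Icc (0 : ℝ) 1) :
    Vq ρ r ≤ 1 - b + ρ * b ^ 2 + ρ * b * (r - 1) :=
  csInf_le ⟨_, (isLeast_quadratic_Bq hρ hr).2⟩ ⟨b, hb, rfl⟩

theorem Bq_pos {ρ r : ℝ} (hρ : 0 < ρ) (hr : r ≤ 1) : 0 < Bq ρ r := by
  have : 0 < 1 / ρ := by positivity
  exact lt_min one_pos (by linarith)

theorem Vq_mono {ρ r s : ℝ} (hρ : 0 < ρ) (hrs : r ≤ s) (hs : s ≤ 1) : Vq ρ r ≤ Vq ρ s := by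
  have hB := Bq_pos hρ hs
  have h := Vq_le hρ (hrs.trans hs) ⟨hB.le, min_le_left _ _⟩
  rw [Vq_eq hρ hs]
  nlinarith [mul_le_mul_of_nonneg_left hrs (mul_pos hρ hB).le]

theorem RStar_le_one {ρ : ℝ} (hρ : 0 < ρ) (n : ℕ) : RStar ρ n ≤ 1 := by
  induction n with
  | zero => exact le_rfl
  | succ n ih => simpa [RStar] using Vq_le hρ ih (b := 0) (by simp)

theorem RStar_succ_le {ρ : ℝ} (hρ : 0 < ρ) (n : ℕ) : RStar ρ (n + 1) ≤ RStar ρ n := by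
  induction n with
  | zero => exact RStar_le_one hρ 1
  | succ n ih => exact Vq_mono hρ ih (RStar_le_one hρ n)

theorem betaStar_succ_pos {ρ : ℝ} (hρ : 0 < ρ) (n : ℕ) : 0 < betaStar ρ (n + 1) :=
  Bq_pos hρ (RStar_le_one hρ n)

theorem betaStar_le_one (ρ : ℝ) (n : ℕ) : betaStar ρ n ≤ 1 := by
  cases n with
  | zero => exact zero_le_one
  | succ n => exact min_le_left _ _

theorem betaStar_monotone {ρ : ℝ} (hρ : 0 < ρ) : Monotone (betaStar ρ) := by
  refine monotone_nat_of_le_succ fun n => ?_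
  cases n with
  | zero => exact (betaStar_succ_pos hρ 0).le
  | succ n =>
    have := RStar_succ_le hρ n
    exact min_le_min_left _ (by linarith)

/-- The optimal bound on `‖x^{n+1} - x^n‖`, relative to `κ₀`. -/
noncomputable def stepStar (ρ : ℝ) (n : ℕ) : ℝ := betaStar ρ (n + 1) + RStar ρ n - 1

theorem RStar_succ {ρ : ℝ} (hρ : 0 < ρ) (n : ℕ) :
    RStar ρ (n + 1) =
      1 - betaStar ρ (n + 1) + betaStar ρ (n + 1) * (ρ * stepStar ρ n) := by
  have h := Vq_eq hρ (RStar_le_one hρ n)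
  simp only [RStar, stepStar, betaStar]
  rw [h]
  ring

theorem stepStar_zero (ρ : ℝ) : stepStar ρ 0 = betaStar ρ 1 := by
  simp [stepStar, RStar]

theorem stepStar_succ {ρ : ℝ} (hρ : 0 < ρ) (n : ℕ) :
    stepStar ρ (n + 1) =
      betaStar ρ (n + 2) - betaStar ρ (n + 1) + betaStar ρ (n + 1) * (ρ * stepStar ρ n) := by
  rw [stepStar, RStar_succ hρ]
  ring

theorem stepStar_nonneg {ρ : ℝ} (hρ : 0 < ρ) (n : ℕ) : 0 ≤ stepStar ρ n := by
  induction n with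
  | zero => exact (stepStar_zero ρ).symm ▸ (betaStar_succ_pos hρ 0).le
  | succ n ih =>
    rw [stepStar_succ hρ]
    have := betaStar_monotone hρ (Nat.le_succ (n + 1))
    have := mul_nonneg (betaStar_succ_pos hρ n).le (mul_nonneg hρ.le ih)
    linarith

theorem mul_stepStar_le_one {ρ : ℝ} (hρ : 0 < ρ) (n : ℕ) : ρ * stepStar ρ n ≤ 1 := by
  have h := RStar_le_one hρ (n + 1)
  rw [RStar_succ hρ] at h
  by_contra! hlt
  nlinarith [betaStar_succ_pos hρ n]

section Bound

variable {E : Type*} [NormedAddCommGroup E] [NormedSpace ℝ E] {ρ κ : ℝ} {C : Set E} {T : E → E}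
  {x : ℕ → E}

theorem halpern_mem (hρ : 0 < ρ) (hC : Convex ℝ C) (hT : Set.MapsTo T C C) (h0 : x 0 ∈ C)
    (hx : ∀ n, x (n + 1) =
      (1 - betaStar ρ (n + 1)) • x 0 + betaStar ρ (n + 1) • T (x n)) (n : ℕ) : x n ∈ C := by
  induction n with
  | zero => exact h0
  | succ n ih =>
    rw [hx]
    exact hC h0 (hT ih) (sub_nonneg.2 (betaStar_le_one ρ _)) (betaStar_succ_pos hρ n).le
      (sub_add_cancel _ _)

theorem norm_smul_add_smul_le_of_nonneg {a b s t : ℝ} {u v : E} (ha : 0 ≤ a) (hb : 0 ≤ b)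
    (hu : ‖u‖ ≤ s) (hv : ‖v‖ ≤ t) : ‖a • u + b • v‖ ≤ a * s + b * t := by
  refine (norm_add_le _ _).trans ?_
  rw [norm_smul_of_nonneg ha, norm_smul_of_nonneg hb]
  gcongr

theorem halpern_step_le (hρ : 0 < ρ)
    (hlip : ∀ n, ‖T (x n) - T (x (n + 1))‖ ≤ ρ * ‖x n - x (n + 1)‖)
    (hx : ∀ n, x (n + 1) = (1 - betaStar ρ (n + 1)) • x 0 + betaStar ρ (n + 1) • T (x n))
    (hκ : ∀ n, ‖x 0 - T (x n)‖ ≤ κ) (n : ℕ) : ‖x n - x (n + 1)‖ ≤ κ * stepStar ρ n := by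
  induction n with
  | zero =>
    have e : x 0 - x 1 = betaStar ρ 1 • (x 0 - T (x 0)) := by rw [hx 0]; module
    rw [e, norm_smul_of_nonneg (betaStar_succ_pos hρ 0).le, stepStar_zero, mul_comm]
    exact mul_le_mul_of_nonneg_right (hκ 0) (betaStar_succ_pos hρ 0).le
  | succ n ih =>
    have e : x (n + 1) - x (n + 1 + 1) =
        (betaStar ρ (n + 2) - betaStar ρ (n + 1)) • (x 0 - T (x (n + 1)))
          + betaStar ρ (n + 1) • (T (x n) - T (x (n + 1))) := by
      rw [hx (n + 1)]
      nth_rewrite 1 [hx n]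
      module
    rw [e, stepStar_succ hρ]
    refine (norm_smul_add_smul_le_of_nonneg
      (sub_nonneg.2 (betaStar_monotone hρ (Nat.le_succ (n + 1)))) (betaStar_succ_pos hρ n).le
      (hκ _) ((hlip n).trans (mul_le_mul_of_nonneg_left ih hρ.le))).trans_eq ?_
    ring

theorem halpern_residual_le (hρ : 0 < ρ)
    (hlip : ∀ n, ‖T (x n) - T (x (n + 1))‖ ≤ ρ * ‖x n - x (n + 1)‖)
    (hx : ∀ n, x (n + 1) = (1 - betaStar ρ (n + 1)) • x 0 + betaStar ρ (n + 1) • T (x n))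
    (hκ : ∀ n, ‖x 0 - T (x n)‖ ≤ κ) (n : ℕ) : ‖x n - T (x n)‖ ≤ κ * RStar ρ n := by
  cases n with
  | zero => simpa [RStar] using hκ 0
  | succ n =>
    have e : x (n + 1) - T (x (n + 1)) = (1 - betaStar ρ (n + 1)) • (x 0 - T (x (n + 1)))
        + betaStar ρ (n + 1) • (T (x n) - T (x (n + 1))) := by
      nth_rewrite 1 [hx n]
      module
    rw [e, RStar_succ hρ]
    refine (norm_smul_add_smul_le_of_nonneg (sub_nonneg.2 (betaStar_le_one ρ _))
      (betaStar_succ_pos hρ n).le (hκ _) ((hlip n).trans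
        (mul_le_mul_of_nonneg_left (halpern_step_le hρ hlip hx hκ n) hρ.le))).trans_eq ?_
    ring

end Bound

section Tight

open scoped BoundedContinuousFunction

/-- Right shift of a real sequence, inserting `0` in front. -/
def shiftRight (z : ℕ → ℝ) : ℕ → ℝ
  | 0 => 0
  | n + 1 => z n

theorem abs_shiftRight_sub_le (a b : ℕ →ᵇ ℝ) (n : ℕ) :
    |shiftRight a n - shiftRight b n| ≤ ‖a - b‖ := by
  cases n with
  | zero => simp [shiftRight]
  | succ n => exact (a - b).norm_coe_le_norm n

/-- Coordinates of the extremal map: a truncated affine function of the shifted sequence. -/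
noncomputable def extremalCoord (ρ κ : ℝ) (z : ℕ → ℝ) (n : ℕ) : ℝ :=
  max 0 (min κ (κ - ρ * (κ * betaStar ρ n - shiftRight z n)))

variable {ρ κ : ℝ}

theorem abs_extremalCoord_le (hκ : 0 < κ) (z : ℕ → ℝ) (n : ℕ) :
    |extremalCoord ρ κ z n| ≤ κ := by
  rw [abs_of_nonneg (le_max_left _ _)]
  exact max_le hκ.le (min_le_left _ _)

theorem abs_extremalCoord_sub_le (hρ : 0 < ρ) (a b : ℕ →ᵇ ℝ) (n : ℕ) :
    |extremalCoord ρ κ a n - extremalCoord ρ κ b n| ≤ ρ * ‖a - b‖ := by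
  have hmax (u v : ℝ) : |max 0 u - max 0 v| ≤ |u - v| := by
    simpa using abs_max_sub_max_le_max 0 u 0 v
  have hmin (u v : ℝ) : |min κ u - min κ v| ≤ |u - v| := by
    simpa using abs_min_sub_min_le_max κ u κ v
  refine (hmax _ _).trans ((hmin _ _).trans ?_)
  rw [show κ - ρ * (κ * betaStar ρ n - shiftRight a n)
      - (κ - ρ * (κ * betaStar ρ n - shiftRight b n))
      = ρ * (shiftRight a n - shiftRight b n) by ring, abs_mul, abs_of_pos hρ]
  exact mul_le_mul_of_nonneg_left (abs_shiftRight_sub_le a b n) hρ.le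

/-- The extremal `ρ`-Lipschitz map on bounded sequences. -/
noncomputable def extremalMap (ρ : ℝ) (hκ : 0 < κ) (z : ℕ →ᵇ ℝ) : ℕ →ᵇ ℝ :=
  BoundedContinuousFunction.ofNormedAddCommGroupDiscrete (extremalCoord ρ κ z) κ
    (abs_extremalCoord_le hκ z)

theorem extremalMap_apply (hκ : 0 < κ) (z : ℕ →ᵇ ℝ) (n : ℕ) :
    extremalMap ρ hκ z n = extremalCoord ρ κ z n := rfl

theorem norm_extremalMap_le (hκ : 0 < κ) (z : ℕ →ᵇ ℝ) : ‖extremalMap ρ hκ z‖ ≤ κ :=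
  (BoundedContinuousFunction.norm_le hκ.le).2 (abs_extremalCoord_le hκ z)

theorem norm_extremalMap_sub_le (hρ : 0 < ρ) (hκ : 0 < κ) (a b : ℕ →ᵇ ℝ) :
    ‖extremalMap ρ hκ a - extremalMap ρ hκ b‖ ≤ ρ * ‖a - b‖ :=
  (BoundedContinuousFunction.norm_le (by positivity)).2 (abs_extremalCoord_sub_le hρ a b)

/-- The Halpern iterates of `extremalMap` started at the origin. -/
noncomputable def extremalSeq (ρ : ℝ) (hκ : 0 < κ) : ℕ → (ℕ →ᵇ ℝ)
  | 0 => 0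
  | n + 1 => betaStar ρ (n + 1) • extremalMap ρ hκ (extremalSeq ρ hκ n)

theorem extremalSeq_succ_apply (hκ : 0 < κ) (j n : ℕ) :
    extremalSeq ρ hκ (j + 1) n =
      betaStar ρ (j + 1) * extremalMap ρ hκ (extremalSeq ρ hκ j) n := rfl

theorem extremalMap_extremalSeq_of_le (hρ : 0 < ρ) (hκ : 0 < κ) {n j : ℕ} (hnj : n ≤ j) :
    extremalMap ρ hκ (extremalSeq ρ hκ j) n = κ := by
  induction n generalizing j with
  | zero => simp [extremalMap_apply, extremalCoord, shiftRight, betaStar, hκ.le]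
  | succ n ih =>
    obtain ⟨j, rfl⟩ : ∃ i, j = i + 1 := ⟨j - 1, by omega⟩
    rw [extremalMap_apply, extremalCoord, shiftRight, extremalSeq_succ_apply, ih (by omega)]
    have hb := mul_le_mul_of_nonneg_left (betaStar_monotone hρ hnj) hκ.le
    rw [min_eq_left, max_eq_right hκ.le]
    nlinarith

theorem extremalMap_extremalSeq_succ (hρ : 0 < ρ) (hκ : 0 < κ) (n : ℕ) :
    extremalMap ρ hκ (extremalSeq ρ hκ n) (n + 1) = κ * (1 - ρ * stepStar ρ n) := by
  have coord_eq (n : ℕ) (h : κ * betaStar ρ (n + 1) - extremalSeq ρ hκ n n = κ * stepStar ρ n) :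
      extremalMap ρ hκ (extremalSeq ρ hκ n) (n + 1) = κ * (1 - ρ * stepStar ρ n) := by
    rw [extremalMap_apply, extremalCoord, shiftRight, h]
    have hnonneg := mul_nonneg hκ.le (mul_nonneg hρ.le (stepStar_nonneg hρ n))
    have hle := mul_le_mul_of_nonneg_left (mul_stepStar_le_one hρ n) hκ.le
    rw [min_eq_right (by linarith), max_eq_right (by linarith)]
    ring
  induction n with
  | zero => exact coord_eq 0 (by simp [extremalSeq, stepStar_zero])
  | succ n ih =>
    refine coord_eq (n + 1) ?_
    rw [extremalSeq_succ_apply, ih, stepStar_succ hρ]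
    ring

theorem le_norm_extremalSeq_sub (hρ : 0 < ρ) (hκ : 0 < κ) (n : ℕ) :
    κ * RStar ρ n ≤ ‖extremalSeq ρ hκ n - extremalMap ρ hκ (extremalSeq ρ hκ n)‖ := by
  refine le_trans ?_
    ((extremalSeq ρ hκ n - extremalMap ρ hκ (extremalSeq ρ hκ n)).norm_coe_le_norm n)
  rw [BoundedContinuousFunction.sub_apply, extremalMap_extremalSeq_of_le hρ hκ le_rfl,
    Real.norm_eq_abs, abs_sub_comm]
  refine le_trans (le_of_eq ?_) (le_abs_self _)
  cases n with
  | zero => simp [extremalSeq, RStar]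
  | succ n =>
    rw [extremalSeq_succ_apply, extremalMap_extremalSeq_succ hρ, RStar_succ hρ]
    ring

end Tight

/-- for any `ρ`-Lipschitz self-map of a nonempty convex set in a real normed
space, the m-opt-halpern iterates (Halpern with `β_n = β*_n`) satisfy
`‖x^n - T x^n‖ ≤ κ₀ R*_n` whenever `‖x⁰ - T x^n‖ ≤ κ₀` for all `n`; and this bound is tight:
some normed space, `ρ`-Lipschitz map and Halpern sequence with these `β*_n` satisfy
`‖x⁰ - T x^n‖ ≤ κ₀` and `‖x^n - T x^n‖ = κ₀ R*_n` for all `n`. -/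
theorem m_opt_halpern (ρ : ℝ) (hρ : 0 < ρ) (κ₀ : ℝ) (hκ₀ : 0 < κ₀) :
    (∀ (E : Type) (_ : NormedAddCommGroup E) (_ : NormedSpace ℝ E)
      (C : Set E), C.Nonempty → Convex ℝ C →
      ∀ T : E → E, Set.MapsTo T C C →
        (∀ x ∈ C, ∀ y ∈ C, ‖T x - T y‖ ≤ ρ * ‖x - y‖) →
        ∀ x : ℕ → E, x 0 ∈ C →
          (∀ n : ℕ, x (n + 1) =
            (1 - betaStar ρ (n + 1)) • x 0 + betaStar ρ (n + 1) • T (x n)) →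
          (∀ n : ℕ, ‖x 0 - T (x n)‖ ≤ κ₀) →
          ∀ n : ℕ, ‖x n - T (x n)‖ ≤ κ₀ * RStar ρ n) ∧
    (∃ (X : Type) (_ : NormedAddCommGroup X) (_ : NormedSpace ℝ X)
      (T : X → X) (x : ℕ → X),
      (∀ a b : X, ‖T a - T b‖ ≤ ρ * ‖a - b‖) ∧
      (∀ n : ℕ, x (n + 1) =
        (1 - betaStar ρ (n + 1)) • x 0 + betaStar ρ (n + 1) • T (x n)) ∧
      (∀ n : ℕ, ‖x 0 - T (x n)‖ ≤ κ₀) ∧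
      (∀ n : ℕ, ‖x n - T (x n)‖ = κ₀ * RStar ρ n)) := by
  constructor
  · intro E _ _ C _ hC T hT hlip x h0 hx hκ
    have hmem := halpern_mem hρ hC hT h0 hx
    exact halpern_residual_le hρ (fun n => hlip _ (hmem n) _ (hmem (n + 1))) hx hκ
  · have hlip := norm_extremalMap_sub_le hρ hκ₀
    have hx (n : ℕ) : extremalSeq ρ hκ₀ (n + 1) =
        (1 - betaStar ρ (n + 1)) • extremalSeq ρ hκ₀ 0
          + betaStar ρ (n + 1) • extremalMap ρ hκ₀ (extremalSeq ρ hκ₀ n) := by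
      simp [extremalSeq]
    have hκ (n : ℕ) :
        ‖extremalSeq ρ hκ₀ 0 - extremalMap ρ hκ₀ (extremalSeq ρ hκ₀ n)‖ ≤ κ₀ := by
      simpa [extremalSeq] using norm_extremalMap_le hκ₀ (extremalSeq ρ hκ₀ n)
    exact ⟨BoundedContinuousFunction ℕ ℝ, inferInstance, inferInstance, extremalMap ρ hκ₀,
      extremalSeq ρ hκ₀, hlip, hx, hκ, fun n =>
        (halpern_residual_le hρ (fun _ => hlip _ _) hx hκ n).antisymm
          (le_norm_extremalSeq_sub hρ hκ₀ n)⟩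
end

section
/- Let T : C → C be ρ-Lipschitz (ρ > 0) on a nonempty convex subset C of a real normed space with a fixed point x* = T x*, let (β_n)_{n≥0} be a non-decreasing sequence in [0,1] with β₀ = 0, let δ₀ ≥ ‖x⁰ − x*‖, and let (x^n) be the Halpern iterates. Then for all n ∈ ℕ: ‖x^n − x*‖ ≤ δ₀ μ_n, ‖x⁰ − T x^n‖ ≤ δ₀ ν_n, ‖x^n − x^{n−1}‖ ≤ δ₀ d♭_n (n ≥ 1), and ‖x^n − T x^n‖ ≤ δ₀ R♭_n. Moreover, for all n ≥ 1, R♭_n = (1+ρ) − (1+3ρ)β_n + 2ρβ_n² + ρβ_n R♭_{n−1}. -/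
/-- `μ₀ = 1`, `μ_n = 1 - β_n + ρ β_n μ_{n-1}`. -/
noncomputable def muSeq (ρ : ℝ) (β : ℕ → ℝ) : ℕ → ℝ
  | 0 => 1
  | n + 1 => 1 - β (n + 1) + ρ * β (n + 1) * muSeq ρ β n

/-- `ν_n = 1 + ρ μ_n`. -/
noncomputable def nuSeq (ρ : ℝ) (β : ℕ → ℝ) (n : ℕ) : ℝ := 1 + ρ * muSeq ρ β n

/-- `d♭₀ = 0`, `d♭_n = (β_n - β_{n-1}) ν_{n-1} + ρ β_{n-1} d♭_{n-1}`. -/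
noncomputable def dFlat (ρ : ℝ) (β : ℕ → ℝ) : ℕ → ℝ
  | 0 => 0
  | n + 1 => (β (n + 1) - β n) * nuSeq ρ β n + ρ * β n * dFlat ρ β n

/-- `R♭_n = (1 - β_n) ν_n + ρ β_n d♭_n`. -/
noncomputable def RFlatSeq (ρ : ℝ) (β : ℕ → ℝ) (n : ℕ) : ℝ :=
  (1 - β n) * nuSeq ρ β n + ρ * β n * dFlat ρ β n

theorem dFlat_succ_eq (ρ : ℝ) (β : ℕ → ℝ) (n : ℕ) :
    dFlat ρ β (n + 1) = RFlatSeq ρ β n - (1 - β (n + 1)) * nuSeq ρ β n := by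
  simp only [dFlat, RFlatSeq]
  ring

theorem RFlatSeq_succ (ρ : ℝ) (β : ℕ → ℝ) (n : ℕ) :
    RFlatSeq ρ β (n + 1) = (1 + ρ) - (1 + 3 * ρ) * β (n + 1) + 2 * ρ * β (n + 1) ^ 2
      + ρ * β (n + 1) * RFlatSeq ρ β n := by
  rw [RFlatSeq, dFlat_succ_eq]
  simp only [nuSeq, muSeq]
  ring

theorem norm_smul_add_smul_le {E : Type*} [SeminormedAddCommGroup E] [NormedSpace ℝ E]
    {a b r s : ℝ} (ha : 0 ≤ a) (hb : 0 ≤ b) {u v : E} (hu : ‖u‖ ≤ r) (hv : ‖v‖ ≤ s) :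
    ‖a • u + b • v‖ ≤ a * r + b * s := by
  refine norm_add_le_of_le ?_ ?_
  · rw [norm_smul_of_nonneg ha]
    gcongr
  · rw [norm_smul_of_nonneg hb]
    gcongr

/-- for a `ρ`-Lipschitz self-map with fixed point `x*`, a non-decreasing
`(β_n) ⊆ [0,1]` with `β₀ = 0`, `δ₀ ≥ ‖x⁰ - x*‖`, and Halpern iterates `(x^n)`:
`‖x^n - x*‖ ≤ δ₀ μ_n`, `‖x⁰ - T x^n‖ ≤ δ₀ ν_n`, `‖x^n - x^{n-1}‖ ≤ δ₀ d♭_n` (`n ≥ 1`),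
`‖x^n - T x^n‖ ≤ δ₀ R♭_n`; and for `n ≥ 1`,
`R♭_n = (1+ρ) - (1+3ρ) β_n + 2ρ β_n² + ρ β_n R♭_{n-1}`. -/
theorem flat_recursive_bounds
    {E : Type*} [NormedAddCommGroup E] [NormedSpace ℝ E]
    {C : Set E} (hCne : C.Nonempty) (hCconv : Convex ℝ C)
    {ρ : ℝ} (hρ : 0 < ρ)
    {T : E → E} (hTmaps : Set.MapsTo T C C)
    (hTlip : ∀ x ∈ C, ∀ y ∈ C, ‖T x - T y‖ ≤ ρ * ‖x - y‖)
    (xstar : E) (hxstarC : xstar ∈ C) (hxstar : T xstar = xstar)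
    (β : ℕ → ℝ) (hβ0 : β 0 = 0) (hβmono : Monotone β)
    (hβ : ∀ n : ℕ, β n ∈ Set.Icc (0 : ℝ) 1)
    (x : ℕ → E) (hx0 : x 0 ∈ C)
    (hx : ∀ n : ℕ, x (n + 1) = (1 - β (n + 1)) • x 0 + β (n + 1) • T (x n))
    (δ₀ : ℝ) (hδ₀ : ‖x 0 - xstar‖ ≤ δ₀) :
    (∀ n : ℕ, ‖x n - xstar‖ ≤ δ₀ * muSeq ρ β n) ∧
    (∀ n : ℕ, ‖x 0 - T (x n)‖ ≤ δ₀ * nuSeq ρ β n) ∧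
    (∀ n : ℕ, 1 ≤ n → ‖x n - x (n - 1)‖ ≤ δ₀ * dFlat ρ β n) ∧
    (∀ n : ℕ, ‖x n - T (x n)‖ ≤ δ₀ * RFlatSeq ρ β n) ∧
    (∀ n : ℕ, 1 ≤ n → RFlatSeq ρ β n =
      (1 + ρ) - (1 + 3 * ρ) * β n + 2 * ρ * (β n) ^ 2 + ρ * β n * RFlatSeq ρ β (n - 1)) := by
  have hβ_nonneg (n) : 0 ≤ β n := (hβ n).1
  have hβ_compl (n) : 0 ≤ 1 - β n := sub_nonneg.2 (hβ n).2
  have hxC (n) : x n ∈ C := by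
    induction n with
    | zero => exact hx0
    | succ n ih =>
      rw [hx]
      exact hCconv hx0 (hTmaps ih) (hβ_compl _) (hβ_nonneg _) (sub_add_cancel _ _)
  have hT_dist {r : ℝ} {y z : E} (hy : y ∈ C) (hz : z ∈ C) (h : ‖y - z‖ ≤ r) :
      ‖T y - T z‖ ≤ ρ * r :=
    (hTlip y hy z hz).trans (by gcongr)
  have hT_fix {r : ℝ} {y : E} (hy : y ∈ C) (h : ‖y - xstar‖ ≤ r) : ‖T y - xstar‖ ≤ ρ * r := by
    simpa only [hxstar] using hT_dist hy hxstarC h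
  have hmu (n) : ‖x n - xstar‖ ≤ δ₀ * muSeq ρ β n := by
    induction n with
    | zero => simpa [muSeq] using hδ₀
    | succ n ih =>
      have h := norm_smul_add_smul_le (hβ_compl (n + 1)) (hβ_nonneg (n + 1)) hδ₀
        (hT_fix (hxC n) ih)
      convert h using 1
      · rw [hx]
        congr 1
        module
      · rw [muSeq]
        ring
  have hnu (n) : ‖x 0 - T (x n)‖ ≤ δ₀ * nuSeq ρ β n := by
    have h := norm_sub_le_of_le hδ₀ (hT_fix (hxC n) (hmu n))
    rw [sub_sub_sub_cancel_right] at h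
    convert h using 1
    rw [nuSeq]
    ring
  have hd (n) : ‖x (n + 1) - x n‖ ≤ δ₀ * dFlat ρ β (n + 1) := by
    induction n with
    | zero =>
      have h : ‖β 1 • (T (x 0) - x 0)‖ ≤ β 1 * (δ₀ * nuSeq ρ β 0) := by
        rw [norm_smul_of_nonneg (hβ_nonneg 1), norm_sub_rev]
        exact mul_le_mul_of_nonneg_left (hnu 0) (hβ_nonneg 1)
      convert h using 1
      · rw [hx]
        congr 1
        module
      · simp only [dFlat, hβ0]
        ring
    | succ n ih =>
      have h := norm_smul_add_smul_le (sub_nonneg.2 (hβmono (n + 1).le_succ))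
        (hβ_nonneg (n + 1)) ((norm_sub_rev _ _).trans_le (hnu (n + 1)))
        (hT_dist (hxC (n + 1)) (hxC n) ih)
      convert h using 1
      · rw [hx (n + 1)]
        nth_rw 2 [hx n]
        congr 1
        module
      · rw [dFlat]
        ring
  have hR (n) : ‖x n - T (x n)‖ ≤ δ₀ * RFlatSeq ρ β n := by
    cases n with
    | zero => simpa [RFlatSeq, hβ0] using hnu 0
    | succ n =>
      have h := norm_smul_add_smul_le (hβ_compl (n + 1)) (hβ_nonneg (n + 1)) (hnu (n + 1))
        (hT_dist (hxC n) (hxC (n + 1)) ((norm_sub_rev _ _).trans_le (hd n)))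
      convert h using 1
      · nth_rw 1 [hx n]
        congr 1
        module
      · rw [RFlatSeq]
        ring
  refine ⟨hmu, hnu, fun n hn => ?_, hR, fun n hn => ?_⟩
  · obtain ⟨n, rfl⟩ := Nat.exists_eq_add_of_le' hn
    exact hd n
  · obtain ⟨n, rfl⟩ := Nat.exists_eq_add_of_le' hn
    exact RFlatSeq_succ ρ β n
end

section
/- Let ρ₀ = 1/2 and ρ_{n+1} = (1 + ρ_n²)/2 for n ≥ 0. Then the sequence (ρ_n^n)_{n≥1} is decreasing and converges to e^{−2}. -/
/-- The sequence `ρ₀ = 1/2`, `ρ_{n+1} = (1 + ρ_n²)/2`. -/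
noncomputable def rhoSeq : ℕ → ℝ
  | 0 => 1 / 2
  | n + 1 => (1 + rhoSeq n ^ 2) / 2

theorem rhoSeq_succ (n : ℕ) : rhoSeq (n + 1) = (1 + rhoSeq n ^ 2) / 2 := rfl

theorem rhoSeq_pos (n : ℕ) : 0 < rhoSeq n := by
  cases n with
  | zero => norm_num [rhoSeq]
  | succ n => rw [rhoSeq_succ]; positivity

theorem rhoSeq_lt_one (n : ℕ) : rhoSeq n < 1 := by
  induction n with
  | zero => norm_num [rhoSeq]
  | succ n ih => rw [rhoSeq_succ]; nlinarith [rhoSeq_pos n]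

theorem add_four_mul_one_sub_rhoSeq_le (n : ℕ) : ((n : ℝ) + 4) * (1 - rhoSeq n) ≤ 2 := by
  induction n with
  | zero => norm_num [rhoSeq]
  | succ n ih =>
    have h0 := rhoSeq_pos n
    have h := mul_le_mul_of_nonneg_right ih (by linarith : 0 ≤ (1 + rhoSeq n) / 2)
    rw [rhoSeq_succ]
    push_cast
    nlinarith [sq_nonneg (1 - rhoSeq n)]

theorem rhoSeq_succ_pow_succ_le (n : ℕ) : rhoSeq (n + 1) ^ (n + 1) ≤ rhoSeq n ^ n := by
  have h0 := rhoSeq_pos n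
  have h1 := rhoSeq_lt_one n
  have hn := add_four_mul_one_sub_rhoSeq_le n
  have hs := rhoSeq_pos (n + 1)
  have hrec := rhoSeq_succ n
  set r := rhoSeq n
  set s := rhoSeq (n + 1)
  have hx : s = r * (1 + (1 - r) ^ 2 / (2 * r)) := by
    rw [hrec]; field_simp; ring
  have hexp : (1 + (1 - r) ^ 2 / (2 * r)) ^ n ≤ Real.exp (n * ((1 - r) ^ 2 / (2 * r))) := by
    rw [Real.exp_nat_mul]
    gcongr
    linarith [Real.add_one_le_exp ((1 - r) ^ 2 / (2 * r))]
  have hexp' : s ≤ Real.exp (s - 1) := by linarith [Real.add_one_le_exp (s - 1)]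
  have hexponent : n * ((1 - r) ^ 2 / (2 * r)) + (s - 1) ≤ 0 := by
    have h : n * ((1 - r) ^ 2 / (2 * r)) ≤ 1 - s := by
      rw [← mul_div_assoc, div_le_iff₀ (by positivity), hrec]
      nlinarith [mul_le_mul_of_nonneg_right hn (by linarith : 0 ≤ 1 - r),
        mul_nonneg (mul_nonneg (by linarith : 0 ≤ 1 - r) (by linarith : 0 ≤ 1 - r)) h0.le,
        pow_nonneg (by linarith : 0 ≤ 1 - r) 3]
    linarith
  calc s ^ (n + 1) = r ^ n * ((1 + (1 - r) ^ 2 / (2 * r)) ^ n * s) := by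
        rw [pow_succ, ← mul_assoc, ← mul_pow, ← hx]
    _ ≤ r ^ n * (Real.exp (n * ((1 - r) ^ 2 / (2 * r))) * Real.exp (s - 1)) := by gcongr
    _ = r ^ n * Real.exp (n * ((1 - r) ^ 2 / (2 * r)) + (s - 1)) := by rw [Real.exp_add]
    _ ≤ r ^ n * 1 := by gcongr; exact Real.exp_le_one_iff.2 hexponent
    _ = r ^ n := mul_one _

theorem tendsto_rhoSeq : Filter.Tendsto rhoSeq Filter.atTop (nhds 1) := by
  have h : Filter.Tendsto (fun n : ℕ => 1 - 2 / ((n : ℝ) + 4)) Filter.atTop (nhds 1) := by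
    have h4 := Filter.tendsto_atTop_add_const_right Filter.atTop (4 : ℝ)
      (tendsto_natCast_atTop_atTop (R := ℝ))
    simpa using (h4.const_div_atTop 2).const_sub 1
  refine tendsto_of_tendsto_of_tendsto_of_le_of_le h tendsto_const_nhds (fun n => ?_)
    fun n => (rhoSeq_lt_one n).le
  have : 1 - rhoSeq n ≤ 2 / ((n : ℝ) + 4) := by
    rw [le_div_iff₀' (by positivity)]
    exact add_four_mul_one_sub_rhoSeq_le n
  linarith

theorem inv_one_sub_rhoSeq_succ_sub (n : ℕ) :
    (1 - rhoSeq (n + 1))⁻¹ - (1 - rhoSeq n)⁻¹ = (1 + rhoSeq n)⁻¹ := by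
  have h0 := rhoSeq_pos n
  have h1 : 1 - rhoSeq n ≠ 0 := by linarith [rhoSeq_lt_one n]
  have h2 : 1 + rhoSeq n ≠ 0 := by positivity
  have h : 1 - rhoSeq (n + 1) = (1 - rhoSeq n) * (1 + rhoSeq n) / 2 := by
    rw [rhoSeq_succ]; ring
  rw [h]
  field_simp
  ring

theorem tendsto_mul_one_sub_rhoSeq :
    Filter.Tendsto (fun n : ℕ => (n : ℝ) * (1 - rhoSeq n)) Filter.atTop (nhds 2) := by
  have hstep : Filter.Tendsto (fun n => (1 + rhoSeq n)⁻¹) Filter.atTop (nhds 2⁻¹) := by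
    convert (tendsto_rhoSeq.const_add 1).inv₀ (by norm_num) using 2
    norm_num
  have hsum : ∀ n, ∑ i ∈ Finset.range n, (1 + rhoSeq i)⁻¹ = (1 - rhoSeq n)⁻¹ - 2 := fun n => by
    simp_rw [← inv_one_sub_rhoSeq_succ_sub]
    rw [Finset.sum_range_sub (fun i => (1 - rhoSeq i)⁻¹)]
    norm_num [rhoSeq]
  have hmean : Filter.Tendsto (fun n : ℕ => (n : ℝ)⁻¹ * (1 - rhoSeq n)⁻¹) Filter.atTop
      (nhds 2⁻¹) := by
    have h := hstep.cesaro.add ((tendsto_inv_atTop_nhds_zero_nat (𝕜 := ℝ)).mul_const 2)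
    simp only [hsum, zero_mul, add_zero] at h
    exact h.congr fun n => by ring
  simpa [mul_comm] using hmean.inv₀ (by norm_num)

/-- the sequence `(ρ_n^n)_{n ≥ 1}` is decreasing and converges to `e⁻²`. -/
theorem rhoSeq_pow_antitone_tendsto :
    (∀ n : ℕ, 1 ≤ n → rhoSeq (n + 1) ^ (n + 1) ≤ rhoSeq n ^ n) ∧
    Filter.Tendsto (fun n : ℕ => rhoSeq n ^ n) Filter.atTop (nhds (Real.exp (-2))) := by
  refine ⟨fun n _ => rhoSeq_succ_pow_succ_le n, ?_⟩
  have h : Filter.Tendsto (fun n : ℕ => (n : ℝ) * (rhoSeq n - 1)) Filter.atTop (nhds (-2)) :=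
    tendsto_mul_one_sub_rhoSeq.neg.congr fun n => by ring
  simpa using Real.tendsto_one_add_pow_exp_of_tendsto h
end

section
/- The function ρ ↦ Q_∞(ρ) = R*_{n₀(ρ)}(ρ)/((1−ρ)·ρ^{n₀(ρ)}) is continuous and monotone increasing on (0,1). -/
/-- `n₀(ρ)`: the smallest `n ∈ ℕ` with `R*_n(ρ) ≤ 1/ρ - 1`. -/
noncomputable def nZero (ρ : ℝ) : ℕ := sInf {n : ℕ | RStar ρ n ≤ 1 / ρ - 1}

/-- `Q_∞(ρ) = R*_{n₀(ρ)}(ρ)/((1-ρ) ρ^{n₀(ρ)})`. -/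
noncomputable def Qinf (ρ : ℝ) : ℝ :=
  RStar ρ (nZero ρ) / ((1 - ρ) * ρ ^ nZero ρ)

open Set Filter Topology

/-- The rescaled defect `ρ (1 - R*_n(ρ))` before the threshold is reached; it does not depend
on `ρ`. -/
noncomputable def defect : ℕ → ℝ
  | 0 => 0
  | n + 1 => (1 + defect n) ^ 2 / 4

/-- The value of `ρ` at which `n₀` jumps from `n` to `n + 1`. -/
noncomputable def breakpoint (n : ℕ) : ℝ := (1 + defect n) / 2

/-- The formula for `Q_∞(ρ)` on the interval where `n₀(ρ) = n`. -/
noncomputable def qPiece (n : ℕ) (x : ℝ) : ℝ := (x - defect n) / ((1 - x) * x ^ (n + 1))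

theorem defect_succ_eq (n : ℕ) : defect (n + 1) = breakpoint n ^ 2 := by
  simp only [defect, breakpoint]; ring

theorem defect_mem (n : ℕ) : 0 ≤ defect n ∧ defect n < 1 := by
  induction n with
  | zero => simp [defect]
  | succ n ih =>
    simp only [defect]
    exact ⟨by positivity, by nlinarith⟩

theorem breakpoint_zero : breakpoint 0 = 1 / 2 := by simp [breakpoint, defect]

theorem breakpoint_mem (n : ℕ) : 1 / 2 ≤ breakpoint n ∧ breakpoint n < 1 := by
  have := defect_mem n
  unfold breakpoint
  constructor <;> linarith

theorem breakpoint_strictMono : StrictMono breakpoint :=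
  strictMono_nat_of_lt_succ fun n => by
    have := defect_mem n
    simp only [breakpoint, defect]
    nlinarith

theorem one_sub_defect_le (n : ℕ) : (1 - defect n) * (n + 4) ≤ 4 := by
  induction n with
  | zero => simp [defect]
  | succ n ih =>
    obtain ⟨h0, h1⟩ := defect_mem n
    simp only [defect]
    push_cast
    nlinarith [mul_nonneg (sub_nonneg.2 h1.le) (sub_nonneg.2 ih), sq_nonneg (1 - defect n)]

theorem Vq_one_sub_div {ρ s : ℝ} (hρ : 0 < ρ) (hs : 0 ≤ s) (h : 1 + s ≤ 2 * ρ) :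
    Vq ρ (1 - s / ρ) = 1 - ((1 + s) ^ 2 / 4) / ρ := by
  apply IsLeast.csInf_eq
  constructor
  · refine ⟨(1 + s) / (2 * ρ), ⟨by positivity, (div_le_one (by positivity)).2 h⟩, ?_⟩
    field_simp
    ring
  · rintro _ ⟨b, -, rfl⟩
    have key : (1 - b + ρ * b ^ 2 + ρ * b * (1 - s / ρ - 1)) - (1 - ((1 + s) ^ 2 / 4) / ρ)
        = ρ * (b - (1 + s) / (2 * ρ)) ^ 2 := by
      field_simp
      ring
    have : 0 ≤ ρ * (b - (1 + s) / (2 * ρ)) ^ 2 := by positivity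
    simp only
    linarith

theorem RStar_eq {ρ : ℝ} (hρ : 0 < ρ) (n : ℕ) (h : ∀ k < n, breakpoint k < ρ) :
    RStar ρ n = 1 - defect n / ρ := by
  induction n with
  | zero => simp [RStar, defect]
  | succ n ih =>
    have hn := h n n.lt_succ_self
    unfold breakpoint at hn
    rw [RStar, ih fun k hk => h k (hk.trans n.lt_succ_self),
      Vq_one_sub_div hρ (defect_mem n).1 (by linarith), defect]

theorem one_sub_div_le_iff {ρ : ℝ} (hρ : 0 < ρ) (n : ℕ) :
    1 - defect n / ρ ≤ 1 / ρ - 1 ↔ ρ ≤ breakpoint n := by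
  have : 1 / ρ - 1 - (1 - defect n / ρ) = 2 * (breakpoint n - ρ) / ρ := by
    unfold breakpoint
    field_simp
    ring
  rw [← sub_nonneg, this, le_div_iff₀ hρ]
  constructor <;> intro h <;> linarith

theorem nZero_eq {ρ : ℝ} (hρ : 0 < ρ) (n : ℕ) (h : ∀ k < n, breakpoint k < ρ)
    (hn : ρ ≤ breakpoint n) : nZero ρ = n := by
  have hmem : n ∈ {n : ℕ | RStar ρ n ≤ 1 / ρ - 1} := by
    rw [mem_ofPred_eq, RStar_eq hρ n h]
    exact (one_sub_div_le_iff hρ n).2 hn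
  refine le_antisymm (Nat.sInf_le hmem) (le_csInf ⟨n, hmem⟩ fun k hk => ?_)
  by_contra! hkn
  rw [mem_ofPred_eq, RStar_eq hρ k fun j hj => h j (hj.trans hkn), one_sub_div_le_iff hρ] at hk
  exact (h k hkn).not_ge hk

theorem Qinf_eq_qPiece {ρ : ℝ} (hρ : 0 < ρ) (n : ℕ) (h : ∀ k < n, breakpoint k < ρ)
    (hn : ρ ≤ breakpoint n) : Qinf ρ = qPiece n ρ := by
  have h1 : 0 < 1 - ρ := by linarith [breakpoint_mem n]
  rw [Qinf, nZero_eq hρ n h hn, RStar_eq hρ n h, qPiece]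
  field_simp
  ring

theorem qPiece_succ_breakpoint (n : ℕ) :
    qPiece (n + 1) (breakpoint n) = qPiece n (breakpoint n) := by
  obtain ⟨h0, h1⟩ := breakpoint_mem n
  have h2 : 0 < 1 - breakpoint n := by linarith
  have h3 : 0 < breakpoint n := by linarith
  have h4 : defect n = 2 * breakpoint n - 1 := by unfold breakpoint; ring
  rw [qPiece, qPiece, defect_succ_eq, h4]
  field_simp
  ring

theorem Qinf_eqOn_succ (n : ℕ) :
    EqOn Qinf (qPiece (n + 1)) (Icc (breakpoint n) (breakpoint (n + 1))) := by
  have hpos : 0 < breakpoint n := by linarith [breakpoint_mem n]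
  rintro x ⟨hx, hx'⟩
  rcases hx.eq_or_lt with rfl | hlt
  · rw [qPiece_succ_breakpoint]
    exact Qinf_eq_qPiece hpos n (fun k hk => breakpoint_strictMono hk) le_rfl
  · exact Qinf_eq_qPiece (hpos.trans hlt) _
      (fun k hk => (breakpoint_strictMono.monotone (Nat.lt_succ_iff.1 hk)).trans_lt hlt) hx'

theorem hasDerivAt_qPiece (n : ℕ) {x : ℝ} (h0 : 0 < x) (h1 : x < 1) :
    HasDerivAt (qPiece n)
      (x ^ n * (x * (1 - defect n) - (n + 1) * ((x - defect n) * (1 - x))) /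
        ((1 - x) * x ^ (n + 1)) ^ 2) x := by
  have hx : (1 - x) * x ^ (n + 1) ≠ 0 := by
    have : 0 < 1 - x := by linarith
    positivity
  have := ((hasDerivAt_id x).sub_const (defect n)).div
    (((hasDerivAt_id x).const_sub 1).mul (hasDerivAt_pow (n + 1) x)) hx
  refine this.congr_deriv ?_
  simp only [id, Pi.mul_apply, Nat.add_sub_cancel]
  push_cast
  ring

theorem continuousOn_qPiece (n : ℕ) : ContinuousOn (qPiece n) (Ioo 0 1) := fun _ hx =>
  (hasDerivAt_qPiece n hx.1 hx.2).continuousAt.continuousWithinAt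

theorem monotoneOn_qPiece (n : ℕ) {a b : ℝ} (ha : 0 < a) (hb : b < 1)
    (h : ∀ x ∈ Ioo a b, (n + 1) * ((x - defect n) * (1 - x)) ≤ x * (1 - defect n)) :
    MonotoneOn (qPiece n) (Icc a b) := by
  refine monotoneOn_of_hasDerivWithinAt_nonneg (f' := fun x => x ^ n *
      (x * (1 - defect n) - (n + 1) * ((x - defect n) * (1 - x))) /
        ((1 - x) * x ^ (n + 1)) ^ 2) (convex_Icc a b)
    ((continuousOn_qPiece n).mono fun x hx => ⟨ha.trans_le hx.1, hx.2.trans_lt hb⟩)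
    (fun x hx => ?_) (fun x hx => ?_)
  · rw [interior_Icc] at hx
    exact (hasDerivAt_qPiece n (ha.trans hx.1) (hx.2.trans hb)).hasDerivWithinAt
  · rw [interior_Icc] at hx
    have := ha.trans hx.1
    have := sub_nonneg.2 (h x hx)
    positivity

theorem monotoneOn_qPiece_succ (n : ℕ) :
    MonotoneOn (qPiece (n + 1)) (Icc (breakpoint n) (breakpoint (n + 1))) := by
  refine monotoneOn_qPiece _ (by linarith [breakpoint_mem n]) (breakpoint_mem _).2
    fun x hx => ?_
  obtain ⟨hx1, hx2⟩ := hx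
  have hu := one_sub_defect_le n
  have hv := one_sub_defect_le (n + 1)
  obtain ⟨hd0, hd1⟩ := defect_mem (n + 1)
  have hx0 : 0 ≤ x := by linarith [breakpoint_mem n]
  unfold breakpoint at hx1
  push_cast at hv ⊢
  set u := 1 - defect n
  set v := 1 - defect (n + 1) 
  have hn : (0 : ℝ) ≤ n := n.cast_nonneg
  -- the arithmetic-geometric mean inequality
  have amgm : (x - defect (n + 1)) * (1 - x) ≤ v ^ 2 / 4 := by
    nlinarith [sq_nonneg ((x - defect (n + 1)) - (1 - x))]
  have hx3 : 1 - u / 2 ≤ x := by simp only [u]; linarith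
  have hx4 : (n + 2) ≤ x * (n + 4) := by nlinarith
  have hkey : (n + 2) * v ≤ 4 * x := by
    have : (n + 2) * v * (n + 5) ≤ 4 * x * (n + 5) := by
      have h1 := mul_le_mul_of_nonneg_left hv (by positivity : (0 : ℝ) ≤ n + 2)
      linarith
    exact le_of_mul_le_mul_right this (by positivity)
  have hvpos : 0 < v := by simp only [v]; linarith
  calc ((n : ℝ) + 1 + 1) * ((x - defect (n + 1)) * (1 - x))
      ≤ (n + 1 + 1) * (v ^ 2 / 4) := by gcongr
    _ ≤ x * v := by nlinarith

theorem Qinf_Icc {a : ℝ} (ha : 0 < a) (ha' : a ≤ 1 / 2) (n : ℕ) :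
    ContinuousOn Qinf (Icc a (breakpoint n)) ∧ MonotoneOn Qinf (Icc a (breakpoint n)) := by
  induction n with
  | zero =>
    have hb := breakpoint_mem 0
    have heq : EqOn Qinf (qPiece 0) (Icc a (breakpoint 0)) := fun x hx =>
      Qinf_eq_qPiece (ha.trans_le hx.1) 0 (by simp) hx.2
    constructor
    · refine ((continuousOn_qPiece 0).mono fun x hx => ?_).congr heq
      exact ⟨ha.trans_le hx.1, hx.2.trans_lt hb.2⟩
    · refine MonotoneOn.congr (monotoneOn_qPiece 0 ha hb.2 fun x hx => ?_) heq.symm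
      simp only [defect, CharP.cast_eq_zero]
      nlinarith [hx.1]
  | succ n ih =>
    have h1 : a ≤ breakpoint n := ha'.trans (breakpoint_mem n).1
    have h2 := breakpoint_strictMono.monotone n.le_succ
    have hb := breakpoint_mem (n + 1)
    rw [← Icc_union_Icc_eq_Icc h1 h2]
    constructor
    · refine ih.1.union_of_isClosed ?_ isClosed_Icc isClosed_Icc
      refine ((continuousOn_qPiece (n + 1)).mono fun x hx => ?_).congr (Qinf_eqOn_succ n)
      exact ⟨ha.trans_le (h1.trans hx.1), hx.2.trans_lt hb.2⟩
    · exact ih.2.union_right ((monotoneOn_qPiece_succ n).congr (Qinf_eqOn_succ n).symm)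
        (isGreatest_Icc h1) (isLeast_Icc h2)

theorem exists_lt_breakpoint {x : ℝ} (hx : x < 1) : ∃ n, x < breakpoint n := by
  obtain ⟨n, hn⟩ := exists_nat_gt (2 / (1 - x))
  refine ⟨n, ?_⟩
  have h := one_sub_defect_le n
  have h1 : 0 < 1 - x := by linarith
  rw [div_lt_iff₀ h1] at hn
  have hn0 : (0 : ℝ) ≤ n := n.cast_nonneg
  unfold breakpoint
  by_contra! hc
  nlinarith

/-- `ρ ↦ Q_∞(ρ)` is continuous and monotone increasing on `(0,1)`. -/
theorem Qinf_continuous_monotone :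
    ContinuousOn Qinf (Set.Ioo (0 : ℝ) 1) ∧ MonotoneOn Qinf (Set.Ioo (0 : ℝ) 1) := by
  constructor
  · rintro x ⟨h0, h1⟩
    obtain ⟨n, hn⟩ := exists_lt_breakpoint h1
    have ha : 0 < min (x / 2) (1 / 2) := by positivity
    refine ((Qinf_Icc ha (min_le_right _ _) n).1.continuousAt ?_).continuousWithinAt
    exact Icc_mem_nhds ((min_le_left _ _).trans_lt (by linarith)) hn
  · rintro x ⟨h0, h1⟩ y ⟨-, hy1⟩ hxy
    obtain ⟨n, hn⟩ := exists_lt_breakpoint hy1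
    have ha : 0 < min x (1 / 2) := by positivity
    have hxa := min_le_left x (1 / 2)
    exact (Qinf_Icc ha (min_le_right _ _) n).2 ⟨hxa, hxy.trans hn.le⟩
      ⟨hxa.trans hxy, hn.le⟩ hxy
end
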